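/- Let a be a nonzero integer and l a positive integer. Then for M ≥ 2, ∑_{M < m ≤ 2M, gcd(m,a)=1} φ(l)/φ(lm) = G_l · log 2 + O(τ(|a|) (log M)/M), where G_l = (φ(|a|)/|a|) · ∏_{p prime, p ∤ a l} (1 + 1/(p(p-1))), and the implied constant is absolute. -/

import Mathlib

open Finset

/-- squarefree-supported multiplicative function with prime values `c p` -/
noncomputable def sfm (c : ℕ → ℝ) (d : ℕ) : ℝ :=
  if Squarefree d then ∏ p ∈ d.primeFactors, c p else 0

lemma swap_sum (h c : ℕ → ℝ) (A B : ℕ) :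
    ∑ m ∈ Ioc A B, h m * ∑ d ∈ m.divisors, c d =
      ∑ d ∈ Ioc 0 B, c d * ∑ k ∈ Ioc (A / d) (B / d), h (d * k) := by
  simp_rw [mul_sum]
  rw [sum_sigma', sum_sigma']
  refine sum_bij' (fun x _ => ⟨x.2, x.1 / x.2⟩) (fun y _ => ⟨y.1 * y.2, y.1⟩) ?_ ?_ ?_ ?_ ?_
  · rintro ⟨m, d⟩ hx
    simp only [mem_sigma, mem_Ioc, Nat.mem_divisors] at hx ⊢
    obtain ⟨⟨h1, h2⟩, ⟨k, rfl⟩, h4⟩ := hx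
    have hd : 0 < d := by
      rcases Nat.eq_zero_or_pos d with rfl | h
      · simp at h4
      · exact h
    have hk : 0 < k := by
      rcases Nat.eq_zero_or_pos k with rfl | h
      · simp at h4
      · exact h
    rw [Nat.mul_div_cancel_left _ hd]
    refine ⟨⟨hd, ?_⟩, ?_, ?_⟩
    · nlinarith
    · rw [Nat.div_lt_iff_lt_mul hd]; linarith [mul_comm d k]
    · rw [Nat.le_div_iff_mul_le hd]; linarith [mul_comm d k]
  · rintro ⟨d, k⟩ hx
    simp only [mem_sigma, mem_Ioc, Nat.mem_divisors] at hx ⊢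
    obtain ⟨⟨h1, h2⟩, h3, h4⟩ := hx
    rw [Nat.div_lt_iff_lt_mul h1] at h3
    rw [Nat.le_div_iff_mul_le h1] at h4
    have := mul_comm d k
    refine ⟨⟨by linarith, by linarith⟩, ⟨k, rfl⟩, by omega⟩
  · rintro ⟨m, d⟩ hx
    simp only [mem_sigma, mem_Ioc, Nat.mem_divisors] at hx ⊢
    rw [Nat.mul_div_cancel' hx.2.1]
  · rintro ⟨d, k⟩ hx
    simp only [mem_sigma, mem_Ioc, Nat.mem_divisors] at hx ⊢
    rw [Nat.mul_div_cancel_left _ hx.1.1]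
  · rintro ⟨m, d⟩ hx
    simp only [mem_sigma, mem_Ioc, Nat.mem_divisors] at hx ⊢
    rw [Nat.mul_div_cancel' hx.2.1]; ring

lemma sfm_divisors (c : ℕ → ℝ) {n : ℕ} (hn : n ≠ 0) :
    ∑ d ∈ n.divisors, sfm c d = ∏ p ∈ n.primeFactors, (1 + c p) := by
  unfold sfm
  rw [← sum_filter, Nat.sum_divisors_filter_squarefree hn, Finset.prod_one_add]
  have : (UniqueFactorizationMonoid.normalizedFactors n).toFinset = n.primeFactors := by
    rw [Nat.factors_eq]; rfl
  rw [this]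
  refine sum_congr rfl fun t ht => ?_
  rw [mem_powerset] at ht
  have : (t.val.prod).primeFactors = t := by
    rw [← Multiset.map_id t.val]
    exact Nat.primeFactors_prod (fun p hp => Nat.prime_of_mem_primeFactors (ht hp))
  rw [this]

lemma sfm_div (c : ℕ → ℝ) (d : ℕ) : sfm c d / d = sfm (fun p => c p / p) d := by
  unfold sfm
  split_ifs with h
  · rw [prod_div_distrib, ← Nat.cast_prod, Nat.prod_primeFactors_of_squarefree h]
  · simp

lemma sfm_mul (c : ℕ → ℝ) {m n : ℕ} (h : Nat.Coprime m n) :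
    sfm c (m * n) = sfm c m * sfm c n := by
  unfold sfm
  simp only [Nat.squarefree_mul h]
  by_cases h1 : Squarefree m <;> by_cases h2 : Squarefree n <;> simp [h1, h2]
  rw [h.primeFactors_mul, prod_union h.disjoint_primeFactors]

lemma sfm_prime_pow (c : ℕ → ℝ) {p : ℕ} (hp : p.Prime) :
    ∑' e : ℕ, sfm c (p ^ e) = 1 + c p := by
  rw [tsum_eq_sum (s := range 2)]
  · simp [sum_range_succ, sfm, hp.primeFactors, hp.prime.squarefree]
  · intro e he
    have : 2 ≤ e := by simpa [Nat.succ_le_iff] using he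
    unfold sfm
    rw [if_neg]
    rw [Nat.squarefree_pow_iff hp.ne_one (by omega)]
    omega

lemma sfm_nonneg {c : ℕ → ℝ} (hc : ∀ p, p.Prime → 0 ≤ c p) (d : ℕ) : 0 ≤ sfm c d := by
  unfold sfm
  split_ifs
  · exact prod_nonneg fun p hp => hc p (Nat.prime_of_mem_primeFactors hp)
  · exact le_rfl

lemma sfm_mono {c c' : ℕ → ℝ} (hc : ∀ p, p.Prime → 0 ≤ c p) (h : ∀ p, p.Prime → c p ≤ c' p)
    (d : ℕ) : sfm c d ≤ sfm c' d := by
  unfold sfm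
  split_ifs
  · exact prod_le_prod (fun p hp => hc p (Nat.prime_of_mem_primeFactors hp))
      fun p hp => h p (Nat.prime_of_mem_primeFactors hp)
  · exact le_rfl

noncomputable def c0 (p : ℕ) : ℝ := 1 / ((p : ℝ) - 1)

lemma c0_nonneg (p : ℕ) (hp : p.Prime) : 0 ≤ c0 p := by
  have : (1 : ℝ) < p := by exact_mod_cast hp.one_lt
  unfold c0; apply div_nonneg <;> linarith

lemma tele (n : ℕ) : ∑ k ∈ Ioc 1 (n + 1), (c0 k / k) = 1 - 1 / ((n : ℝ) + 1) := by
  induction n with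
  | zero => simp
  | succ n ih =>
    rw [sum_Ioc_succ_top (by omega), ih]; unfold c0; push_cast; field_simp; ring

lemma sum_sfm_le (N : ℕ) : ∑ d ∈ Ioc 0 N, sfm c0 d / d ≤ Real.exp 1 := by
  have hnn : ∀ p : ℕ, p.Prime → 0 ≤ c0 p / p := fun p hp => div_nonneg (c0_nonneg p hp) (by positivity)
  simp_rw [sfm_div]
  calc _ ≤ ∑ d ∈ (N.factorial).divisors, sfm (fun p => c0 p / p) d := by
        refine sum_le_sum_of_subset_of_nonneg ?_ fun d _ _ => sfm_nonneg hnn d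
        intro d hd
        simp only [mem_Ioc] at hd
        exact Nat.mem_divisors.2 ⟨Nat.dvd_factorial hd.1 hd.2, Nat.factorial_ne_zero _⟩
    _ = ∏ p ∈ (N.factorial).primeFactors, (1 + c0 p / p) := sfm_divisors _ (Nat.factorial_ne_zero _)
    _ ≤ Real.exp (∑ p ∈ (N.factorial).primeFactors, c0 p / p) := by
        rw [Real.exp_sum]
        refine prod_le_prod (fun p hp => ?_) fun p hp => ?_
        · have := hnn p (Nat.prime_of_mem_primeFactors hp); linarith
        · linarith [Real.add_one_le_exp (c0 p / p)]
    _ ≤ Real.exp 1 := by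
        apply Real.exp_le_exp.2
        calc _ ≤ ∑ k ∈ Ioc 1 (N + 1), (c0 k / k) := by
              refine sum_le_sum_of_subset_of_nonneg ?_ fun d hd _ => ?_
              · intro p hp
                have h1 := Nat.prime_of_mem_primeFactors hp
                have h2 := (h1.dvd_factorial).1 (Nat.dvd_of_mem_primeFactors hp)
                have := h1.one_lt
                simp; omega
              · simp only [mem_Ioc] at hd
                have : (1 : ℝ) < d := by exact_mod_cast hd.1
                unfold c0
                refine div_nonneg (div_nonneg ?_ ?_) ?_ <;> linarith
          _ ≤ 1 := by
              rw [tele]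
              have : (0 : ℝ) ≤ 1 / ((N : ℝ) + 1) := by positivity
              linarith

lemma sfm_c0_le {d : ℕ} (hd : 0 < d) : sfm c0 d ≤ (1 / d) * ∑ e ∈ d.divisors, sfm c0 e := by
  have hR : (0 : ℝ) < d := by exact_mod_cast hd
  by_cases h : Squarefree d
  · rw [sfm_divisors _ hd.ne']
    have : (d : ℝ) = ∏ p ∈ d.primeFactors, (p : ℝ) := by
      rw [← Nat.cast_prod, Nat.prod_primeFactors_of_squarefree h]
    apply le_of_eq
    rw [eq_comm, one_div, inv_mul_eq_iff_eq_mul₀ hR.ne']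
    rw [sfm, if_pos h]
    nth_rw 1 [this]
    rw [← prod_mul_distrib]
    refine prod_congr rfl fun p hp => ?_
    have : (1 : ℝ) < p := by exact_mod_cast (Nat.prime_of_mem_primeFactors hp).one_lt
    have : (p : ℝ) - 1 ≠ 0 := by linarith
    unfold c0; field_simp; ring
  · rw [sfm, if_neg h]
    exact mul_nonneg (by positivity) (sum_nonneg fun e _ => sfm_nonneg c0_nonneg e)

lemma harm (N : ℕ) : ∑ k ∈ Ioc 0 N, (1 / (k : ℝ)) = (harmonic N : ℝ) := by
  rw [harmonic_eq_sum_Icc]; push_cast; simp only [one_div]; rfl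

lemma sum_g (N : ℕ) : ∑ d ∈ Ioc 0 N, sfm c0 d ≤ Real.exp 1 * (1 + Real.log N) := by
  calc _ ≤ ∑ d ∈ Ioc 0 N, (1 / (d : ℝ)) * ∑ e ∈ d.divisors, sfm c0 e :=
        sum_le_sum fun d hd => sfm_c0_le (mem_Ioc.1 hd).1
    _ = ∑ e ∈ Ioc 0 N, sfm c0 e * ∑ k ∈ Ioc (0 / e) (N / e), 1 / ((e * k : ℕ) : ℝ) :=
        swap_sum (fun m => 1 / (m : ℝ)) _ _ _
    _ ≤ ∑ e ∈ Ioc 0 N, (sfm c0 e / e) * (1 + Real.log N) := by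
        refine sum_le_sum fun e he => ?_
        have he0 : (0 : ℝ) < e := by exact_mod_cast (mem_Ioc.1 he).1
        have : ∑ k ∈ Ioc (0 / e) (N / e), 1 / ((e * k : ℕ) : ℝ) = (1 / e) * (harmonic (N / e) : ℝ) := by
          rw [Nat.zero_div, ← harm, mul_sum]
          refine sum_congr rfl fun k _ => ?_
          push_cast; rw [one_div_mul_one_div]
        rw [this, ← mul_assoc, mul_one_div]
        refine mul_le_mul_of_nonneg_left ?_ (div_nonneg (sfm_nonneg c0_nonneg e) he0.le)
        refine (harmonic_le_one_add_log _).trans ?_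
        rcases Nat.eq_zero_or_pos (N / e) with h | h
        · rw [h]; simp; exact Real.log_natCast_nonneg N
        · have : ((N / e : ℕ) : ℝ) ≤ N := by exact_mod_cast Nat.div_le_self N e
          have h' : (0 : ℝ) < ((N / e : ℕ) : ℝ) := by exact_mod_cast h
          linarith [Real.log_le_log h' this]
    _ ≤ _ := by
        rw [← sum_mul]
        exact mul_le_mul_of_nonneg_right (sum_sfm_le N)
          (by linarith [Real.log_natCast_nonneg N])

lemma sq_tail (A N : ℕ) : ∑ k ∈ Ioc A N, (1 / (k : ℝ) ^ 2) ≤ 2 / ((A : ℝ) + 1) := by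
  have key : ∀ n : ℕ, ∑ k ∈ Ioc A (A + n), (1 / (k : ℝ) ^ 2) ≤
      2 / ((A : ℝ) + 1) - 2 / ((A : ℝ) + n + 1) := by
    intro n
    induction n with
    | zero => simp
    | succ n ih =>
      rw [← add_assoc, sum_Ioc_succ_top (by omega)]
      have : 1 / ((A + n + 1 : ℕ) : ℝ) ^ 2 ≤
          2 / ((A : ℝ) + n + 1) - 2 / ((A : ℝ) + (n + 1 : ℕ) + 1) := by
        push_cast
        have h : (0 : ℝ) ≤ (A : ℝ) + n := by positivity
        rw [show (A : ℝ) + (n + 1) + 1 = (A : ℝ) + n + 2 by ring]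
        generalize (A : ℝ) + n = x at h
        rw [div_sub_div _ _ (by positivity) (by positivity), div_le_div_iff₀ (by positivity) (by positivity)]
        nlinarith
      linarith
  rcases le_total A N with h | h
  · obtain ⟨n, rfl⟩ := Nat.exists_eq_add_of_le h
    refine (key n).trans ?_
    have : (0 : ℝ) ≤ 2 / ((A : ℝ) + n + 1) := by positivity
    linarith
  · rw [Ioc_eq_empty (by omega)]; simp; positivity

lemma tail_g (A N : ℕ) : ∑ d ∈ Ioc A N, sfm c0 d / d ≤ 2 * Real.exp 1 / ((A : ℝ) + 1) := by
  calc _ ≤ ∑ d ∈ Ioc A N, (1 / (d : ℝ) ^ 2) * ∑ e ∈ d.divisors, sfm c0 e := by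
        refine sum_le_sum fun d hd => ?_
        have hd0 : 0 < d := by have := (mem_Ioc.1 hd).1; omega
        have hd1 : (0 : ℝ) < d := by exact_mod_cast hd0
        calc sfm c0 d / d ≤ ((1 / d) * ∑ e ∈ d.divisors, sfm c0 e) / d := by
              gcongr; exact sfm_c0_le hd0
          _ = _ := by field_simp
    _ = ∑ e ∈ Ioc 0 N, sfm c0 e * ∑ k ∈ Ioc (A / e) (N / e), 1 / ((e * k : ℕ) : ℝ) ^ 2 :=
        swap_sum (fun m => 1 / (m : ℝ) ^ 2) _ _ _
    _ ≤ ∑ e ∈ Ioc 0 N, (sfm c0 e / e) * (2 / ((A : ℝ) + 1)) := by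
        refine sum_le_sum fun e he => ?_
        have he1 := (mem_Ioc.1 he).1
        have he0 : (0 : ℝ) < e := by exact_mod_cast he1
        have : ∑ k ∈ Ioc (A / e) (N / e), 1 / ((e * k : ℕ) : ℝ) ^ 2 =
            (1 / (e : ℝ) ^ 2) * ∑ k ∈ Ioc (A / e) (N / e), 1 / (k : ℝ) ^ 2 := by
          rw [mul_sum]
          refine sum_congr rfl fun k _ => ?_
          push_cast; rw [one_div_mul_one_div, mul_pow]
        rw [this, div_mul_eq_mul_div (sfm c0 e), mul_div_assoc (sfm c0 e)]
        refine mul_le_mul_of_nonneg_left ?_ (sfm_nonneg c0_nonneg e)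
        have h1 := sq_tail (A / e) (N / e)
        have h2 : (A : ℝ) + 1 ≤ e * (((A / e : ℕ) : ℝ) + 1) := by
          have := Nat.lt_mul_div_succ A he1
          exact_mod_cast this
        calc _ ≤ (1 / (e : ℝ) ^ 2) * (2 / (((A / e : ℕ) : ℝ) + 1)) := by gcongr
          _ = 2 / (e * (((A / e : ℕ) : ℝ) + 1)) / e := by field_simp
          _ ≤ _ := by gcongr
    _ ≤ _ := by
        rw [← sum_mul]
        calc _ ≤ Real.exp 1 * (2 / ((A : ℝ) + 1)) :=
              mul_le_mul_of_nonneg_right (sum_sfm_le N) (by positivity)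
          _ = _ := by ring

lemma log2 {x : ℝ} (hx : 0 < x) :
    |∑ k ∈ Ioc ⌊x⌋₊ ⌊2 * x⌋₊, (1 / (k : ℝ)) - Real.log 2| ≤ 3 / x := by
  set A := ⌊x⌋₊ with hA
  set B := ⌊2 * x⌋₊ with hB
  have hAB : A ≤ B := Nat.floor_le_floor (by linarith)
  have hl0 : 0 < Real.log 2 := Real.log_pos (by norm_num)
  have hl1 : Real.log 2 < 1 := by linarith [Real.log_two_lt_d9]
  rcases lt_or_ge x 1 with h | h
  · have hA0 : A = 0 := Nat.floor_eq_zero.2 h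
    have hB1 : B < 2 := (Nat.floor_lt (by linarith)).2 (by push_cast; linarith)
    have h3 : 1 ≤ 3 / x := by rw [le_div_iff₀ hx]; linarith
    refine le_trans ?_ h3
    rw [hA0]
    interval_cases B
    · simp; rw [abs_of_pos hl0]; exact hl1.le
    · simp; rw [abs_of_pos] <;> linarith
  · have hA1 : 1 ≤ A := Nat.le_floor (by simpa using h)
    have hsum : ∑ k ∈ Ioc A B, (1 / (k : ℝ)) = (harmonic B : ℝ) - harmonic A := by
      rw [← harm, ← harm, ← sum_Ioc_consecutive _ (Nat.zero_le A) hAB]; ring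
    rw [hsum]
    have a1 := Real.eulerMascheroniSeq_lt_eulerMascheroniConstant A
    have a2 := Real.eulerMascheroniConstant_lt_eulerMascheroniSeq' A
    have b1 := Real.eulerMascheroniSeq_lt_eulerMascheroniConstant B
    have b2 := Real.eulerMascheroniConstant_lt_eulerMascheroniSeq' B
    unfold Real.eulerMascheroniSeq at a1 b1
    unfold Real.eulerMascheroniSeq' at a2 b2
    rw [if_neg (by omega)] at a2 b2
    have A0 : (1 : ℝ) ≤ A := by exact_mod_cast hA1
    have B0 : (1 : ℝ) ≤ B := by exact_mod_cast hA1.trans hAB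
    have fa1 : (A : ℝ) ≤ x := Nat.floor_le hx.le
    have fa2 : x < A + 1 := Nat.lt_floor_add_one x
    have fb1 : (B : ℝ) ≤ 2 * x := Nat.floor_le (by linarith)
    have fb2 : 2 * x < B + 1 := Nat.lt_floor_add_one _
    have u : Real.log (B + 1) - Real.log A - Real.log 2 ≤ 3 / x := by
      rw [sub_sub, ← Real.log_mul (by positivity) (by norm_num), ← Real.log_div (by positivity) (by positivity)]
      refine (Real.log_le_sub_one_of_pos (by positivity)).trans ?_
      rw [div_sub_one (by positivity), div_le_div_iff₀ (by positivity) hx]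
      nlinarith
    have v : Real.log 2 + Real.log (A + 1) - Real.log B ≤ 3 / x := by
      rw [← Real.log_mul (by norm_num) (by positivity), ← Real.log_div (by positivity) (by positivity)]
      refine (Real.log_le_sub_one_of_pos (by positivity)).trans ?_
      rw [div_sub_one (by positivity), div_le_div_iff₀ (by positivity) hx]
      nlinarith
    rw [abs_le]; constructor <;> linarith


noncomputable def ca (a p : ℕ) : ℝ := if p ∣ a then -1 else 0

lemma sfm_ca_abs (a e : ℕ) : |sfm (ca a) e| ≤ 1 := by
  unfold sfm
  split_ifs
  · rw [abs_prod]
    refine prod_le_one (fun _ _ => abs_nonneg _) fun p _ => ?_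
    unfold ca; split_ifs <;> simp
  · simp

lemma sfm_ca_zero {a e : ℕ} (h : ¬ e ∣ a) : sfm (ca a) e = 0 := by
  unfold sfm
  split_ifs with hs
  · rw [prod_eq_zero_iff]
    by_contra! hc
    apply h
    rw [← Nat.prod_primeFactors_of_squarefree hs]
    refine Finset.prod_primes_dvd a (fun p hp => (Nat.prime_of_mem_primeFactors hp).prime) ?_
    intro p hp
    have := hc p hp
    by_contra hpa
    simp [ca, hpa] at this
  · rfl

lemma ca_ind {a k : ℕ} (hk : k ≠ 0) :
    ∑ e ∈ k.divisors, sfm (ca a) e = if Nat.gcd a k = 1 then 1 else 0 := by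
  rw [sfm_divisors _ hk]
  split_ifs with h
  · refine prod_eq_one fun p hp => ?_
    have : ¬ p ∣ a := fun hpa =>
      Nat.not_coprime_of_dvd_of_dvd (Nat.prime_of_mem_primeFactors hp).one_lt hpa
        (Nat.dvd_of_mem_primeFactors hp) h
    simp [ca, this]
  · obtain ⟨p, hp, h1, h2⟩ := Nat.Prime.not_coprime_iff_dvd.1 h
    refine prod_eq_zero (i := p) (Nat.mem_primeFactors.2 ⟨hp, h2, hk⟩) ?_
    simp [ca, h1]

lemma tot (n : ℕ) : (n.totient : ℝ) = n * ∏ p ∈ n.primeFactors, (1 - (p : ℝ)⁻¹) := by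
  have h := congrArg (fun q : ℚ => (q : ℝ)) (Nat.totient_eq_mul_prod_factors n)
  push_cast at h
  exact h

lemma ca_tot {a : ℕ} (ha : a ≠ 0) :
    ∑ e ∈ a.divisors, sfm (ca a) e / e = (a.totient : ℝ) / a := by
  simp_rw [sfm_div]
  rw [sfm_divisors _ ha, tot, mul_div_cancel_left₀ _ (by exact_mod_cast ha)]
  refine prod_congr rfl fun p hp => ?_
  simp only [ca, if_pos (Nat.dvd_of_mem_primeFactors hp)]
  ring

lemma coprime_inner_sum {a : ℕ} (ha : a ≠ 0) {x : ℝ} (hx : 0 < x) :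
    |∑ k ∈ Ioc ⌊x⌋₊ ⌊2 * x⌋₊ with Nat.gcd a k = 1, (1 / (k : ℝ))
      - (a.totient : ℝ) / a * Real.log 2| ≤ 3 * a.divisors.card / x := by
  set A := ⌊x⌋₊ with hA
  set B := ⌊2 * x⌋₊ with hB
  have e1 : ∑ k ∈ Ioc A B with Nat.gcd a k = 1, (1 / (k : ℝ)) =
      ∑ e ∈ Ioc 0 B, sfm (ca a) e * ∑ k ∈ Ioc (A / e) (B / e), 1 / ((e * k : ℕ) : ℝ) := by
    rw [← swap_sum (fun m => 1 / (m : ℝ)), sum_filter]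
    refine sum_congr rfl fun k hk => ?_
    rw [ca_ind (by have := (mem_Ioc.1 hk).1; omega)]
    split_ifs <;> simp
  have e2 : ∑ e ∈ Ioc 0 B, sfm (ca a) e * ∑ k ∈ Ioc (A / e) (B / e), 1 / ((e * k : ℕ) : ℝ) =
      ∑ e ∈ a.divisors, sfm (ca a) e * ∑ k ∈ Ioc (A / e) (B / e), 1 / ((e * k : ℕ) : ℝ) := by
    trans ∑ e ∈ Ioc 0 B ∪ a.divisors,
      sfm (ca a) e * ∑ k ∈ Ioc (A / e) (B / e), 1 / ((e * k : ℕ) : ℝ)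
    · refine sum_subset subset_union_left fun e he he' => ?_
      have hea : e ∈ a.divisors := (mem_union.1 he).resolve_left he'
      have : 0 < e := Nat.pos_of_mem_divisors hea
      have hBe : B < e := by
        by_contra hh; exact he' (mem_Ioc.2 ⟨this, by omega⟩)
      rw [Nat.div_eq_of_lt hBe]; simp
    · symm
      refine sum_subset subset_union_right fun e he he' => ?_
      rw [sfm_ca_zero, zero_mul]
      intro h; exact he' (Nat.mem_divisors.2 ⟨h, ha⟩)
  rw [e1, e2, ← ca_tot ha, sum_mul, ← sum_sub_distrib]
  refine (abs_sum_le_sum_abs _ _).trans ?_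
  calc _ ≤ ∑ e ∈ a.divisors, 3 / x := by
        refine sum_le_sum fun e he => ?_
        have he1 := Nat.pos_of_mem_divisors he
        have he0 : (0 : ℝ) < e := by exact_mod_cast he1
        have h1 := log2 (x := x / e) (by positivity)
        rw [← mul_div_assoc, Nat.floor_div_natCast, Nat.floor_div_natCast, ← hA, ← hB] at h1
        have : ∑ k ∈ Ioc (A / e) (B / e), 1 / ((e * k : ℕ) : ℝ) =
            (1 / (e : ℝ)) * ∑ k ∈ Ioc (A / e) (B / e), 1 / (k : ℝ) := by
          rw [mul_sum]
          refine sum_congr rfl fun k _ => ?_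
          push_cast; rw [one_div_mul_one_div]
        rw [this, ← mul_assoc, mul_one_div, ← mul_sub, abs_mul, abs_div, abs_of_pos he0]
        calc _ ≤ (1 / (e : ℝ)) * (3 / (x / e)) := by
              gcongr; exact sfm_ca_abs a e
          _ = 3 / x := by field_simp
    _ = _ := by rw [sum_const, nsmul_eq_mul]; ring

noncomputable def c1 (n p : ℕ) : ℝ := if p ∣ n then 0 else c0 p

lemma c1_nonneg (n p : ℕ) (hp : p.Prime) : 0 ≤ c1 n p := by
  unfold c1; split_ifs
  · exact le_rfl
  · exact c0_nonneg p hp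

lemma c1_le (n p : ℕ) (hp : p.Prime) : c1 n p ≤ c0 p := by
  unfold c1; split_ifs
  · exact c0_nonneg p hp
  · exact le_rfl

lemma g_le (n d : ℕ) : sfm (c1 n) d ≤ sfm c0 d := sfm_mono (c1_nonneg n) (c1_le n) d

lemma g_nonneg (n d : ℕ) : 0 ≤ sfm (c1 n) d := sfm_nonneg (c1_nonneg n) d

lemma f_summable (n : ℕ) : Summable (fun d : ℕ => sfm (c1 n) d / d) := by
  refine summable_of_sum_range_le (c := Real.exp 1) (fun d => div_nonneg (g_nonneg n d) (by positivity)) ?_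
  intro N
  calc _ ≤ ∑ d ∈ range (N + 1), sfm (c1 n) d / d :=
        sum_le_sum_of_subset_of_nonneg (range_subset_range.2 (by omega))
          fun d _ _ => div_nonneg (g_nonneg n d) (by positivity)
    _ = ∑ d ∈ Ioc 0 N, sfm (c1 n) d / d := by
        symm
        apply sum_subset
        · intro d hd; simp at hd ⊢; omega
        · intro d hd hd'
          have : d = 0 := by simp at hd hd'; omega
          simp [this]
    _ ≤ ∑ d ∈ Ioc 0 N, sfm c0 d / d := by
        refine sum_le_sum fun d _ => ?_
        gcongr; exact g_le n d
    _ ≤ _ := sum_sfm_le N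

lemma f_tprod (n : ℕ) : ∏' p : Nat.Primes, (1 + c1 n p / p) = ∑' d : ℕ, sfm (c1 n) d / d := by
  have hs := f_summable n
  simp_rw [sfm_div] at hs ⊢
  rw [← EulerProduct.eulerProduct_tprod (f := sfm (fun p => c1 n p / p))]
  · refine tprod_congr fun p => ?_
    rw [sfm_prime_pow _ p.2]
  · simp [sfm]
  · intro m n h; exact sfm_mul _ h
  · exact hs.norm
  · simp [sfm]

lemma f_tail (n N : ℕ) : |∑ d ∈ Ioc 0 N, sfm (c1 n) d / d - ∑' d : ℕ, sfm (c1 n) d / d| ≤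
    2 * Real.exp 1 / ((N : ℝ) + 1) := by
  have hs := f_summable n
  have hnn : ∀ d : ℕ, 0 ≤ sfm (c1 n) d / d := fun d => div_nonneg (g_nonneg n d) (by positivity)
  rw [abs_sub_comm, abs_of_nonneg (sub_nonneg.2 (hs.sum_le_tsum _ fun d _ => hnn d)), sub_le_iff_le_add]
  refine hs.tsum_le_of_sum_le fun s => ?_
  set K := s.sup id + N with hK
  calc _ ≤ ∑ d ∈ Ioc 0 K, sfm (c1 n) d / d := by
        have : ∑ d ∈ s, sfm (c1 n) d / d = ∑ d ∈ s.erase 0, sfm (c1 n) d / d := by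
          rw [sum_erase]; simp
        rw [this]
        refine sum_le_sum_of_subset_of_nonneg ?_ fun d _ _ => hnn d
        intro d hd
        have h1 := mem_erase.1 hd
        have h2 : d ≤ s.sup id := le_sup (f := id) h1.2
        simp; omega
    _ = ∑ d ∈ Ioc N K, sfm (c1 n) d / d + ∑ d ∈ Ioc 0 N, sfm (c1 n) d / d := by
        rw [← sum_Ioc_consecutive _ (Nat.zero_le N) (by omega : N ≤ K), add_comm]
    _ ≤ _ := by
        gcongr
        refine le_trans (sum_le_sum fun d _ => ?_) (tail_g N K)
        gcongr; exact g_le n d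

lemma ratio {a l m : ℕ} (ha : a ≠ 0) (hl : 0 < l) (hm : 0 < m) (h : Nat.gcd a m = 1) :
    (l.totient : ℝ) / (l * m).totient = (1 / m) * ∑ d ∈ m.divisors, sfm (c1 (a * l)) d := by
  have hlR : (0 : ℝ) < l := by exact_mod_cast hl
  have hmR : (0 : ℝ) < m := by exact_mod_cast hm
  have pos : ∀ s : ℕ, 0 < ∏ p ∈ s.primeFactors, (1 - (p : ℝ)⁻¹) := fun s =>
    prod_pos fun p hp => by
      have : (1 : ℝ) < p := by exact_mod_cast (Nat.prime_of_mem_primeFactors hp).one_lt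
      have := inv_lt_one_of_one_lt₀ this
      linarith
  rw [sfm_divisors _ hm.ne', tot, tot]
  have hu : (l * m).primeFactors = l.primeFactors ∪ (m.primeFactors \ l.primeFactors) := by
    rw [Nat.primeFactors_mul hl.ne' hm.ne', union_sdiff_self_eq_union]
  have e1 : ∏ p ∈ (l * m).primeFactors, (1 - (p : ℝ)⁻¹) =
      (∏ p ∈ l.primeFactors, (1 - (p : ℝ)⁻¹)) *
        ∏ p ∈ m.primeFactors \ l.primeFactors, (1 - (p : ℝ)⁻¹) := by
    rw [hu, prod_union disjoint_sdiff]
  have e2 : ∏ p ∈ m.primeFactors, (1 + c1 (a * l) p) =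
      ∏ p ∈ m.primeFactors \ l.primeFactors, (1 + c1 (a * l) p) := by
    symm
    refine prod_subset sdiff_subset fun p hp hp' => ?_
    have hpl : p ∈ l.primeFactors := by
      by_contra hc; exact hp' (mem_sdiff.2 ⟨hp, hc⟩)
    have : p ∣ a * l := Dvd.dvd.mul_left (Nat.dvd_of_mem_primeFactors hpl) a
    simp [c1, this]
  have e3 : (∏ p ∈ m.primeFactors \ l.primeFactors, (1 + c1 (a * l) p)) *
      ∏ p ∈ m.primeFactors \ l.primeFactors, (1 - (p : ℝ)⁻¹) = 1 := by
    rw [← prod_mul_distrib]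
    refine prod_eq_one fun p hp => ?_
    obtain ⟨h1, h2⟩ := mem_sdiff.1 hp
    have hpp := Nat.prime_of_mem_primeFactors h1
    have hna : ¬ p ∣ a * l := by
      rw [hpp.dvd_mul]
      rintro (h3 | h3)
      · exact Nat.not_coprime_of_dvd_of_dvd hpp.one_lt h3 (Nat.dvd_of_mem_primeFactors h1) h
      · exact h2 (Nat.mem_primeFactors.2 ⟨hpp, h3, hl.ne'⟩)
    have : (1 : ℝ) < p := by exact_mod_cast hpp.one_lt
    have : (p : ℝ) - 1 ≠ 0 := by linarith
    simp only [c1, if_neg hna, c0]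
    field_simp
    ring
  have hpos := pos (l * m)
  rw [e2, div_eq_iff (by have := pos (l * m); push_cast; positivity), e1]
  push_cast
  generalize ∏ p ∈ m.primeFactors \ l.primeFactors, (1 + c1 (a * l) p) = X at *
  generalize ∏ p ∈ m.primeFactors \ l.primeFactors, (1 - (p : ℝ)⁻¹) = Y at *
  generalize ∏ p ∈ l.primeFactors, (1 - (p : ℝ)⁻¹) = Z at *
  field_simp
  linear_combination (-Z) * e3

lemma g_zero {a l d : ℕ} (hd : 0 < d) (h : Nat.gcd a d ≠ 1) : sfm (c1 (a * l)) d = 0 := by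
  unfold sfm
  split_ifs
  · obtain ⟨p, hp, h1, h2⟩ := Nat.Prime.not_coprime_iff_dvd.1 h
    refine prod_eq_zero (i := p) (Nat.mem_primeFactors.2 ⟨hp, h2, hd.ne'⟩) ?_
    simp [c1, Dvd.dvd.mul_right h1 l]
  · rfl

lemma main_expand {a l : ℕ} (ha : a ≠ 0) (hl : 0 < l) (A B : ℕ) :
    ∑ m ∈ Ioc A B with Nat.gcd a m = 1, (l.totient : ℝ) / (l * m).totient =
    ∑ d ∈ Ioc 0 B, sfm (c1 (a * l)) d / d *
      ∑ k ∈ Ioc (A / d) (B / d) with Nat.gcd a k = 1, (1 / (k : ℝ)) := by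
  have e1 : ∑ m ∈ Ioc A B with Nat.gcd a m = 1, (l.totient : ℝ) / (l * m).totient =
      ∑ m ∈ Ioc A B, (if Nat.gcd a m = 1 then 1 / (m : ℝ) else 0) *
        ∑ d ∈ m.divisors, sfm (c1 (a * l)) d := by
    rw [sum_filter]
    refine sum_congr rfl fun m hm => ?_
    split_ifs with h
    · exact ratio ha hl (by have := (mem_Ioc.1 hm).1; omega) h
    · simp
  rw [e1, swap_sum (fun m : ℕ => if Nat.gcd a m = 1 then 1 / (m : ℝ) else 0)]
  refine sum_congr rfl fun d hd => ?_
  have hd1 := (mem_Ioc.1 hd).1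
  by_cases h : Nat.gcd a d = 1
  · rw [div_mul_eq_mul_div, mul_div_assoc, sum_filter, sum_div]
    congr 1
    refine sum_congr rfl fun k _ => ?_
    have : Nat.gcd a (d * k) = 1 ↔ Nat.gcd a k = 1 := by
      change Nat.Coprime _ _ ↔ Nat.Coprime _ _
      rw [Nat.coprime_mul_iff_right]
      exact and_iff_right h
    simp only [this]
    split_ifs
    · push_cast; rw [div_div, mul_comm]
    · simp
  · rw [g_zero hd1 h]; simp

lemma main_nat {a l : ℕ} (ha : a ≠ 0) (hl : 0 < l) {M : ℝ} (hM : 2 ≤ M) :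
    |∑ m ∈ Ioc ⌊M⌋₊ ⌊2 * M⌋₊ with Nat.gcd a m = 1, (l.totient : ℝ) / (l * m).totient
      - (a.totient : ℝ) / a * (∑' d : ℕ, sfm (c1 (a * l)) d / d) * Real.log 2| ≤
      20 * Real.exp 1 * a.divisors.card * Real.log M / M := by
  set A := ⌊M⌋₊ with hA
  set B := ⌊2 * M⌋₊ with hB
  set t : ℝ := (a.divisors.card : ℝ) with ht
  set S := ∑' d : ℕ, sfm (c1 (a * l)) d / d with hS
  set r : ℝ := (a.totient : ℝ) / a with hr
  have hM0 : 0 < M := by linarith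
  have ht1 : 1 ≤ t := by
    rw [ht]; exact_mod_cast Finset.card_pos.2 ⟨1, Nat.one_mem_divisors.2 ha⟩
  have hr0 : 0 ≤ r := by positivity
  have hr1 : r ≤ 1 := by
    have : (0 : ℝ) < a := by exact_mod_cast Nat.pos_of_ne_zero ha
    rw [hr, div_le_one this]; exact_mod_cast Nat.totient_le a
  have hl0 : 0.69 < Real.log 2 := by linarith [Real.log_two_gt_d9]
  have hl1 : Real.log 2 < 0.7 := by linarith [Real.log_two_lt_d9]
  have hlM : Real.log 2 ≤ Real.log M := Real.log_le_log (by norm_num) hM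
  have hBl : 2 * M < B + 1 := Nat.lt_floor_add_one _
  have hBu : (B : ℝ) ≤ 2 * M := Nat.floor_le (by linarith)
  have hB0 : (0 : ℝ) < B := by linarith
  have hlB : Real.log B ≤ Real.log 2 + Real.log M := by
    rw [← Real.log_mul (by norm_num) hM0.ne']
    exact Real.log_le_log hB0 hBu
  rw [main_expand ha hl]
  have p1 : |∑ d ∈ Ioc 0 B, sfm (c1 (a * l)) d / d *
      (∑ k ∈ Ioc (A / d) (B / d) with Nat.gcd a k = 1, (1 / (k : ℝ)) - r * Real.log 2)| ≤
      3 * t / M * (Real.exp 1 * (1 + Real.log B)) := by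
    refine (abs_sum_le_sum_abs _ _).trans ?_
    calc _ ≤ ∑ d ∈ Ioc 0 B, 3 * t / M * sfm c0 d := by
          refine sum_le_sum fun d hd => ?_
          have hd0 : (0 : ℝ) < d := by exact_mod_cast (mem_Ioc.1 hd).1
          have h1 := coprime_inner_sum ha (x := M / d) (by positivity)
          rw [← mul_div_assoc, Nat.floor_div_natCast, Nat.floor_div_natCast, ← hA, ← hB, ← ht, ← hr] at h1
          rw [abs_mul, abs_of_nonneg (div_nonneg (g_nonneg _ d) hd0.le)]
          calc _ ≤ sfm c0 d / d * (3 * t / (M / d)) := by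
                gcongr
                · exact div_nonneg (sfm_nonneg c0_nonneg d) hd0.le
                · exact g_le _ d
            _ = _ := by field_simp
      _ ≤ _ := by
          rw [← mul_sum]
          gcongr; exact sum_g B
  have p2 := f_tail (a * l) B
  rw [← hS] at p2
  have e : ∑ d ∈ Ioc 0 B, sfm (c1 (a * l)) d / d *
      ∑ k ∈ Ioc (A / d) (B / d) with Nat.gcd a k = 1, (1 / (k : ℝ)) - r * S * Real.log 2 =
      ∑ d ∈ Ioc 0 B, sfm (c1 (a * l)) d / d *
      (∑ k ∈ Ioc (A / d) (B / d) with Nat.gcd a k = 1, (1 / (k : ℝ)) - r * Real.log 2) +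
      (r * Real.log 2) * (∑ d ∈ Ioc 0 B, sfm (c1 (a * l)) d / d - S) := by
    simp_rw [mul_sub]
    rw [sum_sub_distrib, ← sum_mul]; ring
  rw [e]
  refine (abs_add_le _ _).trans ?_
  have p3 : |(r * Real.log 2) * (∑ d ∈ Ioc 0 B, sfm (c1 (a * l)) d / d - S)| ≤
      t * Real.exp 1 / M := by
    rw [abs_mul, abs_of_nonneg (by positivity)]
    calc _ ≤ 1 * (2 * Real.exp 1 / ((B : ℝ) + 1)) := by
          gcongr
          nlinarith
      _ ≤ 1 * (2 * Real.exp 1 / (2 * M)) := by gcongr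
      _ = 1 * Real.exp 1 / M := by field_simp
      _ ≤ _ := by gcongr
  calc _ ≤ 3 * t / M * (Real.exp 1 * (1 + Real.log B)) + t * Real.exp 1 / M := add_le_add p1 p3
    _ = (t * Real.exp 1 / M) * (3 * (1 + Real.log B) + 1) := by ring
    _ ≤ (t * Real.exp 1 / M) * (20 * Real.log M) := by gcongr; linarith
    _ = _ := by ring

theorem stmt_3 :
    ∃ C : ℝ, 0 < C ∧ ∀ (a : ℤ) (l : ℕ) (M : ℝ), a ≠ 0 → 0 < l → 2 ≤ M →
      |(∑ m ∈ (Finset.Ioc ⌊M⌋₊ ⌊2 * M⌋₊).filter (fun m : ℕ => Int.gcd a (m : ℤ) = 1),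
          (Nat.totient l : ℝ) / (Nat.totient (l * m) : ℝ))
        - ((Nat.totient a.natAbs : ℝ) / (a.natAbs : ℝ))
          * (∏' p : Nat.Primes,
              if ¬ (((p : ℕ) : ℤ) ∣ a * (l : ℤ)) then
                (1 + 1 / ((p : ℕ) * ((p : ℕ) - 1) : ℝ)) else 1)
          * Real.log 2|
        ≤ C * (a.natAbs.divisors.card : ℝ) * Real.log M / M := by
  refine ⟨20 * Real.exp 1, by positivity, fun a l M ha hl hM => ?_⟩
  have h := main_nat (a := a.natAbs) (by simpa using ha) hl hM
  rw [← f_tprod] at h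
  have e : (∏' p : Nat.Primes,
              if ¬ (((p : ℕ) : ℤ) ∣ a * (l : ℤ)) then
                (1 + 1 / ((p : ℕ) * ((p : ℕ) - 1) : ℝ)) else 1) =
      ∏' p : Nat.Primes, (1 + c1 (a.natAbs * l) p / p) := by
    refine tprod_congr fun p => ?_
    have : (((p : ℕ) : ℤ) ∣ a * (l : ℤ)) ↔ (p : ℕ) ∣ a.natAbs * l := by
      rw [Int.natCast_dvd, Int.natAbs_mul, Int.natAbs_natCast]
    simp only [this, c1, c0]
    split_ifs with h1
    · simp
    · rw [div_div, mul_comm]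
  rw [e]
  exact h
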